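/- Prefix-pair reduction never reorders two actions involving the same participant in the right prefix: if (π, π') →* (σ, σ') (a finite sequence of reduction steps), then for every participant p, the subsequence of σ' consisting of input terms from p is a suffix of the subsequence of π' consisting of input terms from p, and the subsequence of σ' consisting of output terms to p is a suffix of the subsequence of π' consisting of output terms to p; i.e., inputs from p (respectively outputs to p) are consumed from the right prefix strictly in their original order. -/

import Mathlib

/-- A prefix term: an input from `p` or an output to `p`, with label `l` and sort `s`. -/
inductive Term (P L S : Type) : Type
  | inp (p : P) (l : L) (s : S)
  | out (p : P) (l : L) (s : S)

/-- An `𝒜^p`-context: a nonempty finite sequence of input terms from participants `q ≠ p`. -/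
def ACtx {P L S : Type} (p : P) (A : List (Term P L S)) : Prop :=
  A ≠ [] ∧ ∀ t ∈ A, ∃ q l s, t = Term.inp q l s ∧ q ≠ p

/-- A `ℬ^p`-context: a nonempty finite sequence of terms in which every output term
is to a participant `q ≠ p`. -/
def BCtx {P L S : Type} (p : P) (B : List (Term P L S)) : Prop :=
  B ≠ [] ∧ ∀ t ∈ B, ∀ q l s, t = Term.out q l s → q ≠ p

/-- The reduction relation on pairs of prefixes, parameterised by the subsorting
preorder `le` on sorts. -/
inductive Red {P L S : Type} (le : S → S → Prop) :
    List (Term P L S) × List (Term P L S) → List (Term P L S) × List (Term P L S) → Prop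
  | i {p : P} {l : L} {s s' : S} {π π' : List (Term P L S)} :
      le s' s →
      Red le (Term.inp p l s :: π, Term.inp p l s' :: π') (π, π')
  | o {p : P} {l : L} {s s' : S} {π π' : List (Term P L S)} :
      le s s' →
      Red le (Term.out p l s :: π, Term.out p l s' :: π') (π, π')
  | A {p : P} {l : L} {s s' : S} {π π' : List (Term P L S)} {ctx : List (Term P L S)} :
      le s' s → ACtx p ctx →
      Red le (Term.inp p l s :: π, ctx ++ Term.inp p l s' :: π') (π, ctx ++ π')
  | B {p : P} {l : L} {s s' : S} {π π' : List (Term P L S)} {ctx : List (Term P L S)} :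
      le s s' → BCtx p ctx →
      Red le (Term.out p l s :: π, ctx ++ Term.out p l s' :: π') (π, ctx ++ π')

/-- The subsequence of a prefix consisting of the input terms from participant `p`. -/
def inputsFrom {P L S : Type} [DecidableEq P] (p : P) (l : List (Term P L S)) :
    List (Term P L S) :=
  l.filter fun t =>
    match t with
    | Term.inp q _ _ => decide (q = p)
    | Term.out _ _ _ => false

/-- The subsequence of a prefix consisting of the output terms to participant `p`. -/
def outputsTo {P L S : Type} [DecidableEq P] (p : P) (l : List (Term P L S)) :
    List (Term P L S) :=
  l.filter fun t =>
    match t with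
    | Term.inp _ _ _ => false
    | Term.out q _ _ => decide (q = p)

/-- Removing an element from a list deletes the first entry of the filtered list, or nothing,
provided that no earlier element passes the filter whenever the removed one does. -/
theorem filter_append_suffix_filter_append_cons {α : Type*} (f : α → Bool) (c l : List α) (t : α)
    (h : f t = true → ∀ x ∈ c, f x = false) :
    (c ++ l).filter f <:+ (c ++ t :: l).filter f := by
  cases ht : f t with
  | false => simp [ht]
  | true =>
    have hc : c.filter f = [] := by simpa using h ht
    simp [hc, ht]

/-- A single reduction step consumes inputs from `p` and outputs to `p` from the front. -/
theorem Red.inputsFrom_outputsTo_suffix {P L S : Type} [DecidableEq P] {le : S → S → Prop}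
    {a b : List (Term P L S) × List (Term P L S)} (h : Red le a b) (p : P) :
    inputsFrom p b.2 <:+ inputsFrom p a.2 ∧ outputsTo p b.2 <:+ outputsTo p a.2 := by
  cases h with
  | i _ | o _ =>
    constructor <;> exact filter_append_suffix_filter_append_cons _ [] _ _ (by simp)
  | A _ hc =>
    constructor
    · refine filter_append_suffix_filter_append_cons _ _ _ _ fun hp x hx => ?_
      obtain ⟨q, l, s, rfl, hq⟩ := hc.2 x hx
      simp only [decide_eq_true_eq] at hp
      simpa [← hp] using hq
    · exact filter_append_suffix_filter_append_cons _ _ _ _ (by simp)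
  | B _ hc =>
    constructor
    · exact filter_append_suffix_filter_append_cons _ _ _ _ (by simp)
    · refine filter_append_suffix_filter_append_cons _ _ _ _ fun hp x hx => ?_
      simp only [decide_eq_true_eq] at hp
      cases x with
      | inp => rfl
      | out q l s => simpa [← hp] using hc.2 _ hx q l s rfl

theorem stmt3 {P L S : Type} [DecidableEq P] (le : S → S → Prop)
    (π π' σ σ' : List (Term P L S))
    (h : Relation.ReflTransGen (Red le) (π, π') (σ, σ')) :
    ∀ p : P, inputsFrom p σ' <:+ inputsFrom p π' ∧ outputsTo p σ' <:+ outputsTo p π' := by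
  intro p
  suffices H : ∀ b, Relation.ReflTransGen (Red le) (π, π') b →
      inputsFrom p b.2 <:+ inputsFrom p π' ∧ outputsTo p b.2 <:+ outputsTo p π' from H _ h
  intro b hb
  induction hb with
  | refl => exact ⟨List.suffix_refl _, List.suffix_refl _⟩
  | tail _ hstep ih =>
    have hs := hstep.inputsFrom_outputsTo_suffix p
    exact ⟨hs.1.trans ih.1, hs.2.trans ih.2⟩
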